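/- Let f be an nc self-map of 𝔅_d, let X ∈ 𝔅_d(n) and Y ∈ 𝔅_d(m) be fixed points of f_n and f_m respectively, and let Z be a d-tuple of n×m complex matrices such that the d-tuple P with j-th coordinate the 2×2 block matrix P_j = [[X_j, Z_j],[0, Y_j]] lies in 𝔅_d(n+m) and satisfies f_{n+m}(P) = P. Then the Fréchet derivative of f_{n+m} at the direct sum X ⊕ Y fixes the tangent vector N whose j-th coordinate is N_j = [[0, Z_j],[0, 0]]: Df_{n+m}(X ⊕ Y)(N) = N. -/

import Mathlib

open Matrix
open scoped ComplexOrder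

attribute [local instance] Matrix.normedAddCommGroup Matrix.normedSpace

/-- The space of `d`-tuples of `n × n` complex matrices. -/
abbrev MatTuple (d n : ℕ) := Fin d → Matrix (Fin n) (Fin n) ℂ

/-- The free matrix ball at level `n`: strict row contractions. -/
def freeBall (d n : ℕ) : Set (MatTuple d n) :=
  {X | (1 - ∑ j, X j * (X j)ᴴ).PosDef}

/-- The direct sum of two tuples of matrices. -/
def dSum {d n m : ℕ} (X : MatTuple d n) (Y : MatTuple d m) : MatTuple d (n + m) :=
  fun j => Matrix.reindex finSumFinEquiv finSumFinEquiv (Matrix.fromBlocks (X j) 0 0 (Y j))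

/-- An nc self-map of the free ball `𝔅_d`. -/
structure NCSelfMap (d : ℕ) where
  app : ∀ n, MatTuple d n → MatTuple d n
  mapsTo : ∀ n, Set.MapsTo (app n) (freeBall d n) (freeBall d n)
  map_dSum : ∀ {n m : ℕ} (X : MatTuple d n) (Y : MatTuple d m),
    X ∈ freeBall d n → Y ∈ freeBall d m →
    app (n + m) (dSum X Y) = dSum (app n X) (app m Y)
  map_sim : ∀ {n : ℕ} (X : MatTuple d n) (S : Matrix (Fin n) (Fin n) ℂ),
    X ∈ freeBall d n → IsUnit S →
    (fun j => S⁻¹ * X j * S) ∈ freeBall d n →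
    app n (fun j => S⁻¹ * X j * S) = fun j => S⁻¹ * app n X j * S
  holo : ∀ n, DifferentiableOn ℂ (app n) (freeBall d n)

/-- A tuple is generic if its coordinates generate the full matrix algebra. -/
def IsGeneric {d n : ℕ} (X : MatTuple d n) : Prop :=
  Algebra.adjoin ℂ (Set.range X) = ⊤

/-- The homogeneous degree-one linear relations satisfied by the coordinates of `X`. -/
def linRel {d n : ℕ} (X : MatTuple d n) : Set (Fin d → ℂ) :=
  {α | ∑ j, α j • X j = 0}

/-- The scalar point of level `n` associated to a vector in `ℂ^d`. -/
def scalarPt (d n : ℕ) (v : Fin d → ℂ) : MatTuple d n :=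
  fun j => v j • (1 : Matrix (Fin n) (Fin n) ℂ)

namespace Matrix

theorem IsHermitian.posDef_iff_sphere {N : ℕ} {M : Matrix (Fin N) (Fin N) ℂ}
    (hM : M.IsHermitian) :
    M.PosDef ↔ ∀ v ∈ Metric.sphere (0 : Fin N → ℂ) 1, 0 < (star v ⬝ᵥ M *ᵥ v).re := by
  constructor
  · intro h v hv
    have hv0 : v ≠ 0 := by
      rintro rfl
      simp at hv
    exact (Complex.pos_iff.1 (h.dotProduct_mulVec_pos hv0)).1
  · intro h
    refine .of_dotProduct_mulVec_pos hM fun v hv => ?_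
    have him : (star v ⬝ᵥ M *ᵥ v).im = 0 := hM.im_star_dotProduct_mulVec_self v
    refine Complex.pos_iff.2 ⟨?_, him.symm⟩
    have hnorm : ‖v‖ ≠ 0 := norm_ne_zero_iff.2 hv
    have hpos := h (((‖v‖⁻¹ : ℝ) : ℂ) • v) (by simp [norm_smul, hnorm])
    have hscale : star (((‖v‖⁻¹ : ℝ) : ℂ) • v) ⬝ᵥ M *ᵥ (((‖v‖⁻¹ : ℝ) : ℂ) • v)
        = ((‖v‖⁻¹ * ‖v‖⁻¹ : ℝ) : ℂ) * (star v ⬝ᵥ M *ᵥ v) := by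
      simp [mulVec_smul, mul_assoc]
    rw [hscale, Complex.re_ofReal_mul] at hpos
    exact pos_of_mul_pos_right hpos (mul_self_nonneg _)

theorem PosDef.fromBlocks_diagonal {n m : ℕ} {A : Matrix (Fin n) (Fin n) ℂ}
    {B : Matrix (Fin m) (Fin m) ℂ} (hA : A.PosDef) (hB : B.PosDef) :
    (fromBlocks A 0 0 B).PosDef := by
  refine .of_dotProduct_mulVec_pos
    (IsHermitian.fromBlocks hA.isHermitian (by simp) hB.isHermitian) fun v hv => ?_
  obtain ⟨x, y, rfl⟩ : ∃ x y, v = Sum.elim x y := ⟨_, _, (Sum.elim_comp_inl_inr v).symm⟩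
  have hsplit : star (Sum.elim x y) ⬝ᵥ fromBlocks A 0 0 B *ᵥ Sum.elim x y
      = star x ⬝ᵥ A *ᵥ x + star y ⬝ᵥ B *ᵥ y := by
    simp [fromBlocks_mulVec, dotProduct, Fintype.sum_sum_type, Function.comp_def]
  rw [hsplit]
  by_cases hx : x = 0
  · have hy : y ≠ 0 := by
      rintro rfl
      exact hv (by subst hx; ext (i | i) <;> rfl)
    exact add_pos_of_nonneg_of_pos (hA.posSemidef.dotProduct_mulVec_nonneg x)
      (hB.dotProduct_mulVec_pos hy)
  · exact add_pos_of_pos_of_nonneg (hA.dotProduct_mulVec_pos hx)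
      (hB.posSemidef.dotProduct_mulVec_nonneg y)

end Matrix

theorem isHermitian_one_sub_sum {d N : ℕ} (X : MatTuple d N) :
    (1 - ∑ j, X j * (X j)ᴴ).IsHermitian := by
  simp [Matrix.IsHermitian, Matrix.conjTranspose_sum, Matrix.conjTranspose_mul]

theorem isOpen_freeBall (d N : ℕ) : IsOpen (freeBall d N) := by
  refine isOpen_iff_mem_nhds.2 fun X hX => ?_
  have hX' := (isHermitian_one_sub_sum X).posDef_iff_sphere.1 hX
  have hev : ∀ᶠ W in nhds X, ∀ v ∈ Metric.sphere (0 : Fin N → ℂ) 1,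
      0 < (star v ⬝ᵥ (1 - ∑ j, W j * (W j)ᴴ) *ᵥ v).re := by
    refine (isCompact_sphere _ _).eventually_forall_of_forall_eventually fun v hv => ?_
    have hcont : Continuous fun z : MatTuple d N × (Fin N → ℂ) =>
        (star z.2 ⬝ᵥ (1 - ∑ j, z.1 j * (z.1 j)ᴴ) *ᵥ z.2).re := by
      fun_prop
    exact hcont.continuousAt.eventually_const_lt (hX' v hv)
  exact hev.mono fun W hW => (isHermitian_one_sub_sum W).posDef_iff_sphere.2 hW

theorem dSum_mem_freeBall {d n m : ℕ} {X : MatTuple d n} {Y : MatTuple d m}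
    (hX : X ∈ freeBall d n) (hY : Y ∈ freeBall d m) : dSum X Y ∈ freeBall d (n + m) := by
  have hsum : ∑ j, dSum X Y j * (dSum X Y j)ᴴ
      = reindexAlgEquiv ℂ ℂ finSumFinEquiv
        (fromBlocks (∑ j, X j * (X j)ᴴ) 0 0 (∑ j, Y j * (Y j)ᴴ)) := by
    have hblocks : fromBlocks (∑ j, X j * (X j)ᴴ) 0 0 (∑ j, Y j * (Y j)ᴴ)
        = ∑ j, fromBlocks (X j * (X j)ᴴ) 0 0 (Y j * (Y j)ᴴ) := by
      ext (a | a) (b | b) <;> simp [Matrix.sum_apply]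
    rw [hblocks, map_sum]
    refine Finset.sum_congr rfl fun j _ => ?_
    simp [dSum, submatrix_mul_equiv, fromBlocks_multiply, fromBlocks_conjTranspose]
  have hone : 1 - ∑ j, dSum X Y j * (dSum X Y j)ᴴ
      = reindexAlgEquiv ℂ ℂ finSumFinEquiv
        (fromBlocks (1 - ∑ j, X j * (X j)ᴴ) 0 0 (1 - ∑ j, Y j * (Y j)ᴴ)) := by
    rw [hsum, ← map_one (reindexAlgEquiv ℂ ℂ finSumFinEquiv), ← map_sub, ← fromBlocks_one]
    congr 1
    ext (a | a) (b | b) <;> simp [Matrix.one_apply]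
  have hpos := (PosDef.fromBlocks_diagonal hX hY).submatrix
    (finSumFinEquiv (m := n) (n := m)).symm.injective
  rw [freeBall, Set.mem_ofPred_eq, hone]
  exact hpos

/-- The block upper triangular tuple with diagonal blocks `X`, `Y` and corner `Z`. -/
def upperBlock {d n m : ℕ} (X : MatTuple d n) (Z : Fin d → Matrix (Fin n) (Fin m) ℂ)
    (Y : MatTuple d m) : MatTuple d (n + m) :=
  fun j => reindex finSumFinEquiv finSumFinEquiv (fromBlocks (X j) (Z j) 0 (Y j))

theorem upperBlock_smul {d n m : ℕ} (X : MatTuple d n) (Z : Fin d → Matrix (Fin n) (Fin m) ℂ)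
    (Y : MatTuple d m) (t : ℂ) :
    upperBlock X (t • Z) Y = dSum X Y + t • upperBlock 0 Z 0 := by
  ext j a b
  simp only [upperBlock, dSum, Pi.add_apply, Pi.smul_apply, reindex_apply, submatrix_apply,
    Matrix.add_apply, Matrix.smul_apply]
  rcases finSumFinEquiv.symm a with a | a <;> rcases finSumFinEquiv.symm b with b | b <;> simp

/-- The similarity scaling the second block by `t`. -/
def scaleBlock (n m : ℕ) (t : ℂ) : Matrix (Fin (n + m)) (Fin (n + m)) ℂ :=
  reindexAlgEquiv ℂ ℂ finSumFinEquiv (fromBlocks (1 : Matrix (Fin n) (Fin n) ℂ) 0 0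
    (t • (1 : Matrix (Fin m) (Fin m) ℂ)))

theorem scaleBlock_mul_inv {n m : ℕ} {t : ℂ} (ht : t ≠ 0) :
    scaleBlock n m t * scaleBlock n m t⁻¹ = 1 := by
  simp only [scaleBlock, ← map_mul, fromBlocks_multiply]
  simp [ht]

theorem isUnit_scaleBlock {n m : ℕ} {t : ℂ} (ht : t ≠ 0) : IsUnit (scaleBlock n m t) :=
  .of_mul_eq_one _ (scaleBlock_mul_inv ht)

theorem upperBlock_conj_scaleBlock {d n m : ℕ} (X : MatTuple d n)
    (Z : Fin d → Matrix (Fin n) (Fin m) ℂ) (Y : MatTuple d m) {t : ℂ} (ht : t ≠ 0) :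
    (fun j => (scaleBlock n m t)⁻¹ * upperBlock X Z Y j * scaleBlock n m t)
      = upperBlock X (t • Z) Y := by
  funext j
  rw [Matrix.inv_eq_right_inv (scaleBlock_mul_inv ht)]
  change _ * reindexAlgEquiv ℂ ℂ finSumFinEquiv _ * _ = reindexAlgEquiv ℂ ℂ finSumFinEquiv _
  simp only [scaleBlock, ← map_mul, fromBlocks_multiply]
  congr 1
  simp [ht]

/-- if `P = [[X, Z],[0, Y]]` is a fixed point of an nc self-map with `X`
and `Y` fixed, then the derivative at `X ⊕ Y` fixes the strictly upper triangular tangent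
vector `N = [[0, Z],[0, 0]]`. -/
theorem stmt_11 {d n m : ℕ} (f : NCSelfMap d)
    (X : MatTuple d n) (hX : X ∈ freeBall d n) (hfX : f.app n X = X)
    (Y : MatTuple d m) (hY : Y ∈ freeBall d m) (hfY : f.app m Y = Y)
    (Z : Fin d → Matrix (Fin n) (Fin m) ℂ)
    (hP : (fun j => Matrix.reindex finSumFinEquiv finSumFinEquiv
        (Matrix.fromBlocks (X j) (Z j) 0 (Y j))) ∈ freeBall d (n + m))
    (hfP : f.app (n + m) (fun j => Matrix.reindex finSumFinEquiv finSumFinEquiv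
        (Matrix.fromBlocks (X j) (Z j) 0 (Y j))) =
      fun j => Matrix.reindex finSumFinEquiv finSumFinEquiv
        (Matrix.fromBlocks (X j) (Z j) 0 (Y j))) :
    fderiv ℂ (f.app (n + m)) (dSum X Y)
        (fun j => Matrix.reindex finSumFinEquiv finSumFinEquiv
          (Matrix.fromBlocks 0 (Z j) 0 0)) =
      fun j => Matrix.reindex finSumFinEquiv finSumFinEquiv
        (Matrix.fromBlocks 0 (Z j) 0 0) := by
  change fderiv ℂ (f.app (n + m)) (dSum X Y) (upperBlock 0 Z 0) = upperBlock 0 Z 0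
  change upperBlock X Z Y ∈ _ at hP
  change f.app (n + m) (upperBlock X Z Y) = upperBlock X Z Y at hfP
  have hD := dSum_mem_freeBall hX hY
  have hnhds := (isOpen_freeBall d (n + m)).mem_nhds hD
  have hdiff : DifferentiableAt ℂ (f.app (n + m)) (dSum X Y) :=
    (f.holo (n + m)).differentiableAt hnhds
  have hline : HasDerivAt (fun t : ℂ => dSum X Y + t • upperBlock 0 Z 0)
      (upperBlock 0 Z 0) 0 := by
    have hid := ((hasDerivAt_id (0 : ℂ)).smul_const (upperBlock 0 Z 0)).const_add (dSum X Y)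
    rw [one_smul] at hid
    exact hid
  have hzero : dSum X Y + (0 : ℂ) • upperBlock 0 Z 0 = dSum X Y := by
    rw [zero_smul, add_zero]
  have hcomp : HasDerivAt (fun t : ℂ => f.app (n + m) (dSum X Y + t • upperBlock 0 Z 0))
      (fderiv ℂ (f.app (n + m)) (dSum X Y) (upperBlock 0 Z 0)) 0 := by
    refine HasFDerivAt.comp_hasDerivAt (0 : ℂ) ?_ hline
    rw [hzero]
    exact hdiff.hasFDerivAt
  have hmem : ∀ᶠ t : ℂ in nhds 0, dSum X Y + t • upperBlock 0 Z 0 ∈ freeBall d (n + m) :=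
    hline.continuousAt.eventually_mem (by rwa [hzero])
  refine hcomp.unique (hline.congr_of_eventuallyEq ?_)
  filter_upwards [hmem] with t ht
  rcases eq_or_ne t 0 with rfl | h0
  · simp [f.map_dSum X Y hX hY, hfX, hfY]
  · rw [← upperBlock_smul, ← upperBlock_conj_scaleBlock X Z Y h0] at ht ⊢
    rw [f.map_sim _ _ hP (isUnit_scaleBlock h0) ht, hfP]
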